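/- (L-SVD) Let Z ∈ ℝ^{p×p} be invertible and let A ∈ ℝ^{m×n×p}. Then there exist tensors U ∈ ℝ^{m×m×p} and V ∈ ℝ^{n×n×p} that are L-orthogonal (Uᵀ *_L U = U *_L Uᵀ = I_m and Vᵀ *_L V = V *_L Vᵀ = I_n), and an f-diagonal tensor S ∈ ℝ^{m×n×p} (each transform slice L(S)(:,:,k) is diagonal with nonnegative diagonal entries), such that A = U *_L S *_L Vᵀ. -/

import Mathlib

open scoped BigOperators Matrix

namespace LProduct
noncomputable section

/-- A third-order real tensor `ℝ^{m×n×p}`. -/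
abbrev Tensor (m n p : ℕ) : Type := Fin m → Fin n → Fin p → ℝ

/-- Frontal fslice `A(:,:,k) ∈ ℝ^{m×n}`. -/
def fslice {m n p : ℕ} (A : Tensor m n p) (k : Fin p) : Matrix (Fin m) (Fin n) ℝ :=
  Matrix.of fun i j => A i j k

/-- Mode-3 product `(A ×₃ Z)(i,j,k) = Σ_l Z(k,l) A(i,j,l)`. -/
def mode3 {m n p q : ℕ} (Z : Matrix (Fin q) (Fin p) ℝ) (A : Tensor m n p) : Tensor m n q :=
  fun i j k => ∑ l, Z k l * A i j l

/-- Facewise product: fslice-wise matrix multiplication. -/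
def face {m l n p : ℕ} (A : Tensor m l p) (B : Tensor l n p) : Tensor m n p :=
  fun i j k => ∑ r, A i r k * B r j k

/-- The L-product `A *_L B = L⁻¹(L(A) △ L(B))`. -/
def Lmul {m l n p : ℕ} (Z : Matrix (Fin p) (Fin p) ℝ) (A : Tensor m l p) (B : Tensor l n p) :
    Tensor m n p :=
  mode3 Z⁻¹ (face (mode3 Z A) (mode3 Z B))

/-- The L-transpose: `L(Aᵀ)(:,:,k) = (L(A)(:,:,k))ᵀ`. -/
def Ltranspose {m n p : ℕ} (Z : Matrix (Fin p) (Fin p) ℝ) (A : Tensor m n p) : Tensor n m p :=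
  mode3 Z⁻¹ (fun i j k => mode3 Z A j i k)

/-- The L-identity tensor `I_m = L⁻¹(Î)`, where every fslice of `Î` is the identity matrix. -/
def Lid {p : ℕ} (Z : Matrix (Fin p) (Fin p) ℝ) (m : ℕ) : Tensor m m p :=
  mode3 Z⁻¹ (fun i j _ => if i = j then (1 : ℝ) else 0)

/-- Frobenius inner product of two equally-sized tensors. -/
def frob {m n p : ℕ} (A B : Tensor m n p) : ℝ :=
  ∑ i, ∑ j, ∑ k, A i j k * B i j k

/-- Entrywise application of `σ`. -/
def tmap (σ : ℝ → ℝ) {m n p : ℕ} (A : Tensor m n p) : Tensor m n p :=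
  fun i j k => σ (A i j k)

/-- Row-wise softmax of a square matrix. -/
def softmax {T : ℕ} (S : Matrix (Fin T) (Fin T) ℝ) : Matrix (Fin T) (Fin T) ℝ :=
  Matrix.of fun t u => Real.exp (S t u) / ∑ v, Real.exp (S t v)

/-- The sorted eigenvectors of `T† T` and an orthonormal basis extending their normalised images:
the singular value decomposition of `T`. -/
theorem exists_orthonormalBasis_singularValues {m n : ℕ}
    (T : EuclideanSpace ℝ (Fin n) →ₗ[ℝ] EuclideanSpace ℝ (Fin m)) :
    ∃ (u : OrthonormalBasis (Fin m) ℝ (EuclideanSpace ℝ (Fin m)))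
      (v : OrthonormalBasis (Fin n) ℝ (EuclideanSpace ℝ (Fin n))),
      ∀ j : Fin n, T (v j) =
        ∑ i : Fin m, (if (i : ℕ) = (j : ℕ) then T.singularValues j else 0) • u i := by
  have hn : Module.finrank ℝ (EuclideanSpace ℝ (Fin n)) = n := by simp
  have hm : Module.finrank ℝ (EuclideanSpace ℝ (Fin m)) = Fintype.card (Fin m) := by simp
  have hrank : Module.finrank ℝ T.range ≤ m := by
    simpa using T.range.finrank_le
  set v := T.isSymmetric_adjoint_comp_self.eigenvectorBasis hn with hv
  have hinner (i j : Fin n) :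
      inner ℝ (T (v i)) (T (v j)) = if i = j then T.singularValues j ^ 2 else 0 := by
    have heig := T.isSymmetric_adjoint_comp_self.apply_eigenvectorBasis hn j
    rw [← hv, ← T.sq_singularValues_fin hn, LinearMap.comp_apply] at heig
    rw [← LinearMap.adjoint_inner_right, heig, inner_smul_right,
      orthonormal_iff_ite.mp v.orthonormal]
    simp
  have hzero (j : Fin n) (hj : T.singularValues j = 0) : T (v j) = 0 := by
    rw [← inner_self_eq_zero (𝕜 := ℝ), hinner]
    simp [hj]
  let w : Fin m → EuclideanSpace ℝ (Fin m) := fun i =>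
    if h : (i : ℕ) < n then (T.singularValues i)⁻¹ • T (v ⟨i, h⟩) else 0
  let s : Set (Fin m) := {i | T.singularValues i ≠ 0}
  have hlt (i : s) : (i : ℕ) < n := by
    by_contra h
    exact i.2 (T.singularValues_of_finrank_le (by omega))
  have hw : Orthonormal ℝ (s.domRestrict w) := by
    rw [orthonormal_iff_ite]
    intro i j
    have hj : T.singularValues (j : Fin m) ≠ 0 := j.2
    simp only [Set.domRestrict_apply, w, hlt, dif_pos, inner_smul_left, inner_smul_right, hinner,
      Fin.mk.injEq, Fin.val_inj, Subtype.coe_inj]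
    split_ifs with hij
    · subst hij
      simp only [conj_trivial]
      field_simp
    · simp
  obtain ⟨u, hu⟩ := hw.exists_orthonormalBasis_extension_of_card_eq hm
  refine ⟨u, v, fun j => ?_⟩
  by_cases hj : T.singularValues j = 0
  · simp [hj, hzero]
  · have hjm : (j : ℕ) < m :=
      (T.singularValues_pos_iff_lt_finrank_range.mp
        (lt_of_le_of_ne (T.singularValues_nonneg j) (Ne.symm hj))).trans_le hrank
    rw [Finset.sum_eq_single ⟨j, hjm⟩ (fun i _ hi => by
      rw [if_neg (fun h => hi (Fin.ext h)), zero_smul]) (by simp), hu _ hj]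
    simp [w, smul_smul, hj]

/-- The matrix whose columns are an orthonormal basis is orthogonal. -/
theorem transpose_mul_self_of_orthonormalBasis {m : ℕ}
    (u : OrthonormalBasis (Fin m) ℝ (EuclideanSpace ℝ (Fin m))) :
    (Matrix.of fun i j => u j i)ᵀ * (Matrix.of fun i j => u j i) = 1 := by
  ext i j
  rw [Matrix.one_apply, ← orthonormal_iff_ite.mp u.orthonormal i j]
  simp [Matrix.mul_apply, PiLp.inner_apply, mul_comm]

/-- Every real matrix has a singular value decomposition. -/
theorem exists_matrix_svd {m n : ℕ} (A : Matrix (Fin m) (Fin n) ℝ) :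
    ∃ (U : Matrix (Fin m) (Fin m) ℝ) (S : Matrix (Fin m) (Fin n) ℝ) (V : Matrix (Fin n) (Fin n) ℝ),
      Uᵀ * U = 1 ∧ Vᵀ * V = 1 ∧
      (∀ (i : Fin m) (j : Fin n), ((i : ℕ) ≠ (j : ℕ) → S i j = 0) ∧
        ((i : ℕ) = (j : ℕ) → 0 ≤ S i j)) ∧
      A = U * (S * Vᵀ) := by
  set T := Matrix.toEuclideanLin A with hT
  obtain ⟨u, v, huv⟩ := exists_orthonormalBasis_singularValues T
  refine ⟨Matrix.of fun i j => u j i,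
    Matrix.of fun i j => if (i : ℕ) = (j : ℕ) then T.singularValues j else 0,
    Matrix.of fun i j => v j i, transpose_mul_self_of_orthonormalBasis u,
    transpose_mul_self_of_orthonormalBasis v, fun i j => ⟨fun h => by simp [h], fun h => ?_⟩, ?_⟩
  · simpa [h] using T.singularValues_nonneg j
  · have hV := mul_eq_one_comm.mp (transpose_mul_self_of_orthonormalBasis v)
    rw [← Matrix.mul_assoc]
    refine (Matrix.mul_one A).symm.trans ?_
    rw [← hV, ← Matrix.mul_assoc]
    congr 1
    ext i j
    have h := congrArg (fun x : EuclideanSpace ℝ (Fin m) => x i) (huv j)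
    simp only [hT, Matrix.toLpLin_apply, Matrix.mulVec, dotProduct, WithLp.ofLp_sum,
      Finset.sum_apply, PiLp.smul_apply, smul_eq_mul] at h
    simp only [Matrix.mul_apply, Matrix.of_apply]
    rw [h]
    exact Finset.sum_congr rfl fun _ _ => mul_comm _ _

theorem mode3_mode3_inv {m n p : ℕ} {Z : Matrix (Fin p) (Fin p) ℝ} (hZ : IsUnit Z)
    (A : Tensor m n p) : mode3 Z (mode3 Z⁻¹ A) = A := by
  have h : Z * Z⁻¹ = 1 := Matrix.mul_nonsing_inv Z ((Matrix.isUnit_iff_isUnit_det Z).mp hZ)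
  funext i j
  change Z *ᵥ (Z⁻¹ *ᵥ A i j) = A i j
  rw [Matrix.mulVec_mulVec, h, Matrix.one_mulVec]

theorem mode3_inv_mode3 {m n p : ℕ} {Z : Matrix (Fin p) (Fin p) ℝ} (hZ : IsUnit Z)
    (A : Tensor m n p) : mode3 Z⁻¹ (mode3 Z A) = A := by
  have h : Z⁻¹ * Z = 1 := Matrix.nonsing_inv_mul Z ((Matrix.isUnit_iff_isUnit_det Z).mp hZ)
  funext i j
  change Z⁻¹ *ᵥ (Z *ᵥ A i j) = A i j
  rw [Matrix.mulVec_mulVec, h, Matrix.one_mulVec]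

/-- The tensor whose transform-domain frontal slices are the given matrices. -/
def ofTransformSlices {m n p : ℕ} (Z : Matrix (Fin p) (Fin p) ℝ)
    (M : Fin p → Matrix (Fin m) (Fin n) ℝ) : Tensor m n p :=
  mode3 Z⁻¹ fun i j k => M k i j

theorem fslice_mode3_ofTransformSlices {m n p : ℕ} {Z : Matrix (Fin p) (Fin p) ℝ} (hZ : IsUnit Z)
    (M : Fin p → Matrix (Fin m) (Fin n) ℝ) (k : Fin p) :
    fslice (mode3 Z (ofTransformSlices Z M)) k = M k := by
  rw [ofTransformSlices, mode3_mode3_inv hZ]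
  rfl

theorem ofTransformSlices_fslice_mode3 {m n p : ℕ} {Z : Matrix (Fin p) (Fin p) ℝ} (hZ : IsUnit Z)
    (A : Tensor m n p) : ofTransformSlices Z (fslice (mode3 Z A)) = A :=
  mode3_inv_mode3 hZ A

theorem Lmul_ofTransformSlices {m l n p : ℕ} {Z : Matrix (Fin p) (Fin p) ℝ} (hZ : IsUnit Z)
    (M : Fin p → Matrix (Fin m) (Fin l) ℝ) (N : Fin p → Matrix (Fin l) (Fin n) ℝ) :
    Lmul Z (ofTransformSlices Z M) (ofTransformSlices Z N) =
      ofTransformSlices Z fun k => M k * N k := by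
  simp only [Lmul, ofTransformSlices, mode3_mode3_inv hZ]
  rfl

theorem Ltranspose_ofTransformSlices {m n p : ℕ} {Z : Matrix (Fin p) (Fin p) ℝ} (hZ : IsUnit Z)
    (M : Fin p → Matrix (Fin m) (Fin n) ℝ) :
    Ltranspose Z (ofTransformSlices Z M) = ofTransformSlices Z fun k => (M k)ᵀ := by
  simp only [Ltranspose, ofTransformSlices, mode3_mode3_inv hZ]
  rfl

theorem ofTransformSlices_one {p : ℕ} (Z : Matrix (Fin p) (Fin p) ℝ) (m : ℕ) :
    ofTransformSlices Z (fun _ => (1 : Matrix (Fin m) (Fin m) ℝ)) = Lid Z m := by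
  simp only [ofTransformSlices, Lid, Matrix.one_apply]

/-- L-SVD: every A ∈ ℝ^{m×n×p} admits a factorization
A = U *_L S *_L Vᵀ with U, V L-orthogonal and S f-diagonal with nonnegative
diagonal entries in the transform domain. -/
theorem L_SVD {m n p : ℕ}
    (Z : Matrix (Fin p) (Fin p) ℝ) (hZ : IsUnit Z) (A : Tensor m n p) :
    ∃ (U : Tensor m m p) (S : Tensor m n p) (V : Tensor n n p),
      (Lmul Z (Ltranspose Z U) U = Lid Z m ∧ Lmul Z U (Ltranspose Z U) = Lid Z m) ∧
      (Lmul Z (Ltranspose Z V) V = Lid Z n ∧ Lmul Z V (Ltranspose Z V) = Lid Z n) ∧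
      (∀ (k : Fin p) (i : Fin m) (j : Fin n),
        ((i : ℕ) ≠ (j : ℕ) → fslice (mode3 Z S) k i j = 0) ∧
        ((i : ℕ) = (j : ℕ) → 0 ≤ fslice (mode3 Z S) k i j)) ∧
      A = Lmul Z U (Lmul Z S (Ltranspose Z V)) := by
  choose U S V hU hV hS hA using fun k => exists_matrix_svd (fslice (mode3 Z A) k)
  refine ⟨ofTransformSlices Z U, ofTransformSlices Z S, ofTransformSlices Z V,
    ⟨?_, ?_⟩, ⟨?_, ?_⟩, fun k i j => ?_, ?_⟩
  · simp only [Ltranspose_ofTransformSlices hZ, Lmul_ofTransformSlices hZ, hU,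
      ofTransformSlices_one]
  · simp only [Ltranspose_ofTransformSlices hZ, Lmul_ofTransformSlices hZ,
      mul_eq_one_comm.mp (hU _), ofTransformSlices_one]
  · simp only [Ltranspose_ofTransformSlices hZ, Lmul_ofTransformSlices hZ, hV,
      ofTransformSlices_one]
  · simp only [Ltranspose_ofTransformSlices hZ, Lmul_ofTransformSlices hZ,
      mul_eq_one_comm.mp (hV _), ofTransformSlices_one]
  · rw [fslice_mode3_ofTransformSlices hZ]
    exact hS k i j
  · simp only [Ltranspose_ofTransformSlices hZ, Lmul_ofTransformSlices hZ, ← hA]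
    exact (ofTransformSlices_fslice_mode3 hZ A).symm

end
end LProduct
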